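/- arXiv:2101.05050 — 2 statements merged into one kernel-verified Lean document; each statement's English description precedes it below -/
import Mathlib

section
/- Let a first-order language L be fixed, and let B, E⁺, E⁻ and the clause language 𝓛 be sets of L-sentences. Define the Top program ⊤ = {C ∈ 𝓛 | (∃ e ∈ E⁺, B ∪ {C} ⊨ e) ∧ (∀ e ∈ E⁻, ¬(B ∪ {C} ⊨ e))}. Assume entailment is positively clause-decomposable and negatively clause-decomposable over 𝓛. If there exists a correct hypothesis H ⊆ 𝓛, then ⊤ is a correct hypothesis, i.e. (∀ e ∈ E⁺, B ∪ ⊤ ⊨ e) and (∀ e ∈ E⁻, ¬(B ∪ ⊤ ⊨ e)). (Paper's Theorem 1, Top program correctness.) -/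
open FirstOrder

/-- **Paper's Theorem 1 (Top program correctness).** If entailment is positively
and negatively clause-decomposable over the clause language `𝓛` and there exists
a correct hypothesis `H ⊆ 𝓛`, then the Top program is a correct hypothesis. -/
theorem top_program_correctness {L : FirstOrder.Language}
    (𝓛 B Epos Eneg : L.Theory)
    (hposdec : ∀ H ⊆ 𝓛, ∀ e ∈ Epos, (B ∪ H) ⊨ᵇ e → ∃ C ∈ H, (B ∪ {C}) ⊨ᵇ e)
    (hnegdec : ∀ H ⊆ 𝓛, ∀ e ∈ Eneg, (B ∪ H) ⊨ᵇ e → ∃ C ∈ H, (B ∪ {C}) ⊨ᵇ e)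
    (hcorrect : ∃ H ⊆ 𝓛, (∀ e ∈ Epos, (B ∪ H) ⊨ᵇ e) ∧ (∀ e ∈ Eneg, ¬ ((B ∪ H) ⊨ᵇ e))) :
    (∀ e ∈ Epos,
      (B ∪ {C ∈ 𝓛 | (∃ e ∈ Epos, (B ∪ {C}) ⊨ᵇ e) ∧ ∀ e ∈ Eneg, ¬ ((B ∪ {C}) ⊨ᵇ e)}) ⊨ᵇ e) ∧
    (∀ e ∈ Eneg,
      ¬ ((B ∪ {C ∈ 𝓛 | (∃ e ∈ Epos, (B ∪ {C}) ⊨ᵇ e) ∧ ∀ e ∈ Eneg, ¬ ((B ∪ {C}) ⊨ᵇ e)}) ⊨ᵇ e)) := by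
  have mono : ∀ {T T' : L.Theory} {e : L.Sentence}, T ⊆ T' → T ⊨ᵇ e → T' ⊨ᵇ e :=
    fun hsub he => FirstOrder.Language.Theory.models_of_models_theory
      (fun φ hφ => FirstOrder.Language.Theory.models_sentence_of_mem (hsub hφ)) he
  obtain ⟨H, hH, hp, hn⟩ := hcorrect
  refine ⟨fun e he => ?_, fun e he h => ?_⟩
  · obtain ⟨C, hC, hCe⟩ := hposdec H hH e he (hp e he)
    refine mono (Set.union_subset_union_right B (Set.singleton_subset_iff.2 ?_)) hCe
    exact ⟨hH hC, ⟨e, he, hCe⟩, fun e' he' h' => hn e' he'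
      (mono (Set.union_subset_union_right B (Set.singleton_subset_iff.2 hC)) h')⟩
  · obtain ⟨C, hC, hCe⟩ := hnegdec _ (fun _ hx => hx.1) e he h
    exact hC.2.2 e he hCe
end

section
/- Let a first-order language L be fixed, and let B, E⁺, E⁻ and the clause language 𝓛 be sets of L-sentences, with Top program ⊤ = {C ∈ 𝓛 | (∃ e ∈ E⁺, B ∪ {C} ⊨ e) ∧ (∀ e ∈ E⁻, ¬(B ∪ {C} ⊨ e))}. Assume entailment is positively clause-decomposable over 𝓛 and that entailment is monotone in the theory (if T ⊆ T' and T ⊨ φ then T' ⊨ φ). If there exists a correct hypothesis H ⊆ 𝓛, then for every e ∈ E⁺ we have B ∪ ⊤ ⊨ e. (Completeness half of the paper's Theorem 1.) -/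
open FirstOrder

/-- **Completeness half of the paper's Theorem 1.** If entailment is positively
clause-decomposable over `𝓛` and monotone in the theory, and a correct hypothesis
`H ⊆ 𝓛` exists, then the Top program entails every positive example. -/
theorem top_program_completeness {L : FirstOrder.Language}
    (𝓛 B Epos Eneg : L.Theory)
    (hposdec : ∀ H ⊆ 𝓛, ∀ e ∈ Epos, (B ∪ H) ⊨ᵇ e → ∃ C ∈ H, (B ∪ {C}) ⊨ᵇ e)
    (hmono : ∀ (T T' : L.Theory) (φ : L.Sentence), T ⊆ T' → T ⊨ᵇ φ → T' ⊨ᵇ φ)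
    (hcorrect : ∃ H ⊆ 𝓛, (∀ e ∈ Epos, (B ∪ H) ⊨ᵇ e) ∧ (∀ e ∈ Eneg, ¬ ((B ∪ H) ⊨ᵇ e))) :
    ∀ e ∈ Epos,
      (B ∪ {C ∈ 𝓛 | (∃ e ∈ Epos, (B ∪ {C}) ⊨ᵇ e) ∧ ∀ e ∈ Eneg, ¬ ((B ∪ {C}) ⊨ᵇ e)}) ⊨ᵇ e := by
  intro e he
  obtain ⟨H, hH, hpos, hneg⟩ := hcorrect
  obtain ⟨C, hC, hCe⟩ := hposdec H hH e he (hpos e he)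
  refine hmono (B ∪ {C}) _ e (Set.union_subset_union_right B ?_) hCe
  refine Set.singleton_subset_iff.mpr ⟨hH hC, ⟨e, he, hCe⟩, fun e' he' h => hneg e' he' ?_⟩
  exact hmono (B ∪ {C}) _ e'
    (Set.union_subset_union_right B (Set.singleton_subset_iff.mpr hC)) h
end
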